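/- arXiv:1511.08133 — 7 statements merged into one kernel-verified Lean document; each statement's English description precedes it below -/
import Mathlib

section
/- Let (X,d) be a finite ultrametric space with |X| ≥ 2. Then (X,d) is nonrigid; more precisely, there exists a surjective self-isometry g of X with |Fix(g)| ≤ |X| − 2 (in particular g is not the identity). -/
/-- In an ultrametric space, two points at minimal positive distance are equidistant from every
other point. -/
theorem dist_eq_dist_of_forall_dist_le {X : Type*} [MetricSpace X] [IsUltrametricDist X] {a b : X}
    (hmin : ∀ x y : X, x ≠ y → dist a b ≤ dist x y) {z : X} (ha : z ≠ a) (hb : z ≠ b) :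
    dist z a = dist z b := by
  apply le_antisymm
  · exact (dist_triangle_max z b a).trans
      (max_le le_rfl ((dist_comm b a).trans_le (hmin z b hb)))
  · exact (dist_triangle_max z a b).trans (max_le le_rfl (hmin z a ha))

/-- In an ultrametric space, swapping two points at minimal positive distance is an isometry. -/
theorem dist_swap_of_forall_dist_le {X : Type*} [MetricSpace X] [IsUltrametricDist X]
    [DecidableEq X] {a b : X} (hmin : ∀ x y : X, x ≠ y → dist a b ≤ dist x y) (x y : X) :
    dist (Equiv.swap a b x) (Equiv.swap a b y) = dist x y := by
  have key := fun z => dist_eq_dist_of_forall_dist_le hmin (z := z)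
  simp only [Equiv.swap_apply_def]
  grind [dist_comm, dist_self]

/-- Every finite ultrametric space `X` with `|X| ≥ 2` is
nonrigid: there exists a surjective self-isometry `g` of `X` having at most
`|X| - 2` fixed points (in particular, `g` is not the identity). -/
theorem stmt4 (X : Type*) [MetricSpace X] [IsUltrametricDist X] [Fintype X]
    (hcard : 2 ≤ Fintype.card X) :
    ∃ g : X → X, Function.Surjective g ∧ (∀ x y : X, dist (g x) (g y) = dist x y) ∧
      {x : X | g x = x}.ncard ≤ Fintype.card X - 2 := by
  classical
  obtain ⟨u, v, huv⟩ := Fintype.one_lt_card_iff.mp hcard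
  obtain ⟨⟨a, b⟩, hab, hmin⟩ := Set.exists_min_image {p : X × X | p.1 ≠ p.2}
    (fun p => dist p.1 p.2) (Set.toFinite _) ⟨(u, v), huv⟩
  refine ⟨Equiv.swap a b, (Equiv.swap a b).surjective,
    dist_swap_of_forall_dist_le fun x y hxy => hmin (x, y) hxy, ?_⟩
  have hsub : {x : X | Equiv.swap a b x = x} ⊆ ({a, b} : Set X)ᶜ := by
    rintro x hx (rfl | rfl)
    · exact hab (by simpa using hx.symm)
    · exact hab (by simpa using hx)
  refine (Set.ncard_le_ncard hsub).trans_eq ?_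
  rw [Set.ncard_compl, Set.ncard_pair hab, Nat.card_eq_fintype_card]
end

section
/- Let (X,d) be a nonempty finite ultrametric space, let (B_i)_{i ∈ I} be a family of balls of X that are pairwise disjoint, and for each i ∈ I let ψ_i : B_i → B_i be a bijection with d(ψ_i(x),ψ_i(y)) = d(x,y) for all x,y ∈ B_i. Then the map ψ : X → X defined by ψ(x) = ψ_i(x) for x ∈ B_i and ψ(x) = x for x ∉ ⋃_{i∈I} B_i is a surjective self-isometry of (X,d). -/
/-- The set of all (closed) balls of a metric space. -/
def metricBalls (X : Type*) [MetricSpace X] : Set (Set X) :=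
  {B | ∃ (t : X) (r : ℝ), 0 ≤ r ∧ B = {x : X | dist x t ≤ r}}

/-- A point outside a ball of an ultrametric space is equidistant from all points of the ball. -/
theorem dist_eq_of_mem_metricBalls {X : Type*} [MetricSpace X] [IsUltrametricDist X]
    {B : Set X} (hB : B ∈ metricBalls X) {x x' y : X} (hx : x ∈ B) (hx' : x' ∈ B)
    (hy : y ∉ B) : dist x y = dist x' y := by
  obtain ⟨t, r, -, rfl⟩ := hB
  simp only [Set.mem_ofPred_eq, not_le] at hx hx' hy
  have dist_center : ∀ z : X, dist z t ≤ r → dist z y = dist t y := by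
    intro z hz
    have h₁ := dist_triangle_max z t y
    have h₂ := dist_triangle_max t z y
    have h₃ := dist_triangle_max y z t
    rw [dist_comm t z] at h₂
    rw [dist_comm y t] at hy h₃
    rw [dist_comm y z] at h₃
    grind
  rw [dist_center x hx, dist_center x' hx']

/-- Let `X` be a nonempty finite ultrametric space, let
`(B i)_{i ∈ I}` be a family of pairwise disjoint balls of `X`, and for each
`i` let `ψ` restrict to a distance-preserving bijection of `B i` onto itself;
suppose moreover that `ψ` is the identity off `⋃ i, B i`.  Then `ψ` is a
surjective self-isometry of `X`. -/
theorem stmt5 (X : Type*) [MetricSpace X] [IsUltrametricDist X] [Fintype X]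
    [Nonempty X] (I : Type*) (B : I → Set X)
    (hballs : ∀ i, B i ∈ metricBalls X)
    (hdisj : ∀ i j, i ≠ j → Disjoint (B i) (B j))
    (ψ : X → X)
    (hbij : ∀ i, Set.BijOn ψ (B i) (B i))
    (hiso : ∀ i, ∀ x ∈ B i, ∀ y ∈ B i, dist (ψ x) (ψ y) = dist x y)
    (hid : ∀ x : X, x ∉ ⋃ i, B i → ψ x = x) :
    Function.Surjective ψ ∧ ∀ x y : X, dist (ψ x) (ψ y) = dist x y := by
  have map_mem_or_eq : ∀ x, (∃ i, x ∈ B i ∧ ψ x ∈ B i) ∨ ψ x = x := by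
    intro x
    by_cases h : x ∈ ⋃ i, B i
    · obtain ⟨i, hi⟩ := Set.mem_iUnion.mp h
      exact Or.inl ⟨i, hi, (hbij i).mapsTo hi⟩
    · exact Or.inr (hid x h)
  have dist_map_right : ∀ x y, (∀ i, y ∈ B i → x ∉ B i) → dist x (ψ y) = dist x y := by
    intro x y h
    rcases map_mem_or_eq y with ⟨i, hy, hψy⟩ | hy
    · rw [dist_comm x, dist_comm x]
      exact dist_eq_of_mem_metricBalls (hballs i) hψy hy (h i hy)
    · rw [hy]
  have map_notMem : ∀ i y, y ∉ B i → ψ y ∉ B i := by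
    intro i y hy hψy
    rcases map_mem_or_eq y with ⟨j, hj, hψj⟩ | h
    · have hij : i ≠ j := by
        rintro rfl
        exact hy hj
      exact Set.disjoint_left.mp (hdisj i j hij) hψy hψj
    · exact hy (h ▸ hψy)
  refine ⟨fun y => ?_, fun x y => ?_⟩
  · by_cases h : y ∈ ⋃ i, B i
    · obtain ⟨i, hi⟩ := Set.mem_iUnion.mp h
      obtain ⟨x, -, hx⟩ := (hbij i).surjOn hi
      exact ⟨x, hx⟩
    · exact ⟨y, hid y h⟩
  · by_cases h : ∃ i, x ∈ B i ∧ y ∈ B i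
    · obtain ⟨i, hx, hy⟩ := h
      exact hiso i x hx y hy
    · push Not at h
      have hxy : dist (ψ x) (ψ y) = dist x (ψ y) := by
        rcases map_mem_or_eq x with ⟨i, hx, hψx⟩ | hx
        · exact dist_eq_of_mem_metricBalls (hballs i) hψx hx (map_notMem i y (h i hx))
        · rw [hx]
      rw [hxy, dist_map_right x y fun i hy hx => h i hx hy]
end

section
/- Let (X,d) and (Y,ρ) be finite ultrametric spaces with |X| = |Y| ≥ 2. If Y ∈ ℜ, then |Sp(X)| ≤ |Sp(Y)|. -/
/-- The metricSpectrum of a metric space: the set of distances between its points. -/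
def metricSpectrum (X : Type*) [MetricSpace X] : Set ℝ :=
  {r : ℝ | ∃ x y : X, dist x y = r}

/-- Membership in the class `ℜ`: every surjective self-isometry of `X` has at
least `|X| - 2` fixed points. -/
def maxRigid (X : Type*) [MetricSpace X] : Prop :=
  ∀ g : X → X, Function.Surjective g → (∀ x y : X, dist (g x) (g y) = dist x y) →
    Nat.card X - 2 ≤ {x : X | g x = x}.ncard

open Finset in
/-- Adjoining a point to a finite subset of an ultrametric space creates at most one new
distance. -/
theorem card_image_dist_le {X : Type*} [MetricSpace X] [IsUltrametricDist X] [DecidableEq X]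
    (S : Finset X) : #((S ×ˢ S).image fun p => dist p.1 p.2) ≤ #S := by
  classical
  induction S using Finset.induction_on with
  | empty => simp
  | insert a S ha ih =>
    rcases S.eq_empty_or_nonempty with rfl | hS
    · simp
    obtain ⟨b, hb, hmin⟩ := S.exists_min_image (fun y => dist a y) hS
    have key : ∀ y ∈ S, dist a y = dist a b ∨ dist a y = dist b y := by
      intro y hy
      rcases (hmin y hy).eq_or_lt with h | h
      · exact Or.inl h.symm
      · right
        have h1 := IsUltrametricDist.dist_triangle_max a b y
        have h2 := IsUltrametricDist.dist_triangle_max b a y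
        rw [dist_comm b a] at h2
        rcases le_max_iff.1 h1 with h3 | h3
        · exact absurd h3 h.not_ge
        · exact le_antisymm h3 (h2.trans (max_le h.le le_rfl))
    have hsub : ((insert a S ×ˢ insert a S).image fun p : X × X => dist p.1 p.2) ⊆
        insert (dist a b) ((S ×ˢ S).image fun p => dist p.1 p.2) := by
      intro r hr
      simp only [mem_image, mem_product, Prod.exists, mem_insert] at hr ⊢
      obtain ⟨x, y, ⟨rfl | hx, rfl | hy⟩, rfl⟩ := hr
      · exact Or.inr ⟨b, b, ⟨hb, hb⟩, by simp⟩
      · exact (key y hy).imp_right fun h => ⟨b, y, ⟨hb, hy⟩, h.symm⟩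
      · rw [dist_comm x y]
        exact (key x hx).imp_right fun h => ⟨b, x, ⟨hb, hx⟩, h.symm⟩
      · exact Or.inr ⟨x, y, ⟨hx, hy⟩, rfl⟩
    rw [card_insert_of_notMem ha]
    exact (card_le_card hsub).trans ((card_insert_le _ _).trans (by omega))

theorem finite_metricSpectrum (X : Type*) [MetricSpace X] [Finite X] :
    (metricSpectrum X).Finite := by
  have h : metricSpectrum X = Set.range fun p : X × X => dist p.1 p.2 := by
    ext r
    simp [metricSpectrum]
  rw [h]
  exact Set.finite_range _

theorem ncard_metricSpectrum_le_card (X : Type*) [MetricSpace X] [IsUltrametricDist X]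
    [Fintype X] : (metricSpectrum X).ncard ≤ Fintype.card X := by
  classical
  have h : metricSpectrum X =
      (((Finset.univ ×ˢ Finset.univ).image fun p : X × X => dist p.1 p.2 : Finset ℝ) : Set ℝ) := by
    ext r
    simp [metricSpectrum]
  rw [h, Set.ncard_coe_finset]
  exact card_image_dist_le Finset.univ

/-- Two distinct points are twins if each is a nearest neighbour of the other. -/
def AreTwins {Y : Type*} [MetricSpace Y] (a b : Y) : Prop :=
  a ≠ b ∧ (∀ z, z ≠ a → dist a b ≤ dist a z) ∧ ∀ z, z ≠ b → dist a b ≤ dist b z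

theorem AreTwins.dist_eq {Y : Type*} [MetricSpace Y] [IsUltrametricDist Y] {a b z : Y}
    (h : AreTwins a b) (hza : z ≠ a) (hzb : z ≠ b) : dist a z = dist b z := by
  have h1 := IsUltrametricDist.dist_triangle_max a b z
  have h2 := IsUltrametricDist.dist_triangle_max b a z
  rw [dist_comm b a] at h2
  exact le_antisymm (h1.trans (max_le (h.2.2 z hzb) le_rfl))
    (h2.trans (max_le (h.2.1 z hza) le_rfl))

theorem AreTwins.dist_swap {Y : Type*} [MetricSpace Y] [IsUltrametricDist Y] [DecidableEq Y]
    {a b : Y} (h : AreTwins a b) (x y : Y) :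
    dist (Equiv.swap a b x) (Equiv.swap a b y) = dist x y := by
  have key : ∀ z, z ≠ a → z ≠ b → dist a z = dist b z := fun z => h.dist_eq
  have key' : ∀ z, z ≠ a → z ≠ b → dist z a = dist z b := fun z hza hzb => by
    rw [dist_comm z a, dist_comm z b, key z hza hzb]
  have hab := dist_comm a b
  simp only [Equiv.swap_apply_def]
  split_ifs <;> simp_all

/-- In a space of class `ℜ` there is at most one pair of twins. -/
theorem AreTwins.sym2_eq {Y : Type*} [MetricSpace Y] [IsUltrametricDist Y] [Fintype Y]
    (hY : maxRigid Y) {a b c d : Y} (hab : AreTwins a b) (hcd : AreTwins c d) :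
    s(a, b) = s(c, d) := by
  classical
  set g : Equiv.Perm Y := Equiv.swap a b * Equiv.swap c d with hg
  have hfix := hY g g.surjective fun x y => by
    simp only [hg, Equiv.Perm.mul_apply, hab.dist_swap, hcd.dist_swap]
  have hset : {x : Y | g x = x} = ((g.supportᶜ : Finset Y) : Set Y) := by
    ext x
    simp
  rw [hset, Set.ncard_coe_finset, Finset.card_compl, Nat.card_eq_fintype_card] at hfix
  have htwo : 2 ≤ Fintype.card Y := Fintype.one_lt_card_iff.2 ⟨a, b, hab.1⟩
  have hsupp : g.support.card ≤ 2 := by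
    have := g.support.card_le_univ
    omega
  have hsign : Equiv.Perm.sign g = 1 := by
    simp [hg, Equiv.Perm.sign_swap hab.1, Equiv.Perm.sign_swap hcd.1]
  have hone : g = 1 := by
    by_contra hne
    have hswap : g.IsSwap := Equiv.Perm.card_support_eq_two.1
      (le_antisymm hsupp (Equiv.Perm.two_le_card_support_of_ne_one hne))
    have := hswap.sign_eq
    rw [hsign] at this
    exact absurd this (by decide)
  have heq : Equiv.swap a b = Equiv.swap c d := by
    rw [hg, mul_eq_one_iff_eq_inv, Equiv.swap_inv] at hone
    exact hone
  have hb : Equiv.swap c d a = b := by rw [← heq, Equiv.swap_apply_left]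
  rw [Sym2.eq_iff]
  by_cases hac : a = c
  · subst hac
    exact Or.inl ⟨rfl, by rw [← hb, Equiv.swap_apply_left]⟩
  by_cases had : a = d
  · subst had
    exact Or.inr ⟨rfl, by rw [← hb, Equiv.swap_apply_right]⟩
  · exact absurd (by rw [← hb, Equiv.swap_apply_of_ne_of_ne hac had]) hab.1

open Finset in
/-- Every ball with at least two points of a finite ultrametric space contains a pair of twins. -/
theorem exists_areTwins {Y : Type*} [MetricSpace Y] [IsUltrametricDist Y] [Fintype Y] {x y : Y}
    (hxy : x ≠ y) :
    ∃ a b : Y, AreTwins a b ∧ dist x a ≤ dist x y ∧ dist x b ≤ dist x y := by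
  classical
  obtain ⟨⟨a, b⟩, hmem, hmin⟩ := exists_min_image
    (univ.filter fun p : Y × Y => p.1 ≠ p.2 ∧ dist x p.1 ≤ dist x y ∧ dist x p.2 ≤ dist x y)
    (fun p => dist p.1 p.2) ⟨(x, y), by simp [hxy]⟩
  simp only [mem_filter, mem_univ, true_and, Prod.forall, and_imp] at hmem hmin
  obtain ⟨hab, ha, hb⟩ := hmem
  have hle : dist a b ≤ dist x y := by
    refine (IsUltrametricDist.dist_triangle_max a x b).trans (max_le ?_ hb)
    rwa [dist_comm]
  have key : ∀ c z, dist x c ≤ dist x y → z ≠ c → dist a b ≤ dist c z := by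
    intro c z hc hz
    by_cases hxz : dist x z ≤ dist x y
    · exact hmin c z hz.symm hc hxz
    · rcases le_max_iff.1 (IsUltrametricDist.dist_triangle_max x c z) with h | h
      · exact absurd (h.trans hc) hxz
      · exact hle.trans ((not_le.1 hxz).le.trans h)
  exact ⟨a, b, ⟨hab, fun z => key a z ha, fun z => key b z hb⟩, ha, hb⟩

open Finset in
theorem exists_nearest_neighbour {Y : Type*} [MetricSpace Y] [Fintype Y] [Nontrivial Y] (x : Y) :
    ∃ y, y ≠ x ∧ ∀ z, z ≠ x → dist x y ≤ dist x z := by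
  classical
  obtain ⟨w, hw⟩ := exists_ne x
  obtain ⟨y, hy, hmin⟩ := exists_min_image (univ.erase x) (fun y => dist x y) ⟨w, by simp [hw]⟩
  exact ⟨y, by simpa using hy, fun z hz => hmin z (by simp [hz])⟩

open Finset in
/-- The distance to a nearest neighbour is injective once one of the two twins is removed. -/
theorem card_le_ncard_metricSpectrum {Y : Type*} [MetricSpace Y] [IsUltrametricDist Y]
    [Fintype Y] [Nontrivial Y] (hY : maxRigid Y) :
    Fintype.card Y ≤ (metricSpectrum Y).ncard := by
  classical
  choose n hne hn using exists_nearest_neighbour (Y := Y)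
  have twins : ∀ x y, x ≠ y → dist x (n x) = dist y (n y) → AreTwins x y := by
    intro x y hxy hr
    obtain ⟨a, b, hab, ha, hb⟩ := exists_areTwins (hne x).symm
    obtain ⟨c, d, hcd, hc, hd⟩ := exists_areTwins (hne y).symm
    have hya : dist y a ≤ dist y (n y) := by
      rcases Sym2.eq_iff.1 (hab.sym2_eq hY hcd) with ⟨rfl, rfl⟩ | ⟨rfl, rfl⟩ <;> assumption
    have hle : dist x y ≤ dist x (n x) := by
      refine (IsUltrametricDist.dist_triangle_max x a y).trans (max_le ha ?_)
      rw [dist_comm a y, hr]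
      exact hya
    exact ⟨hxy, fun z hz => hle.trans (hn x z hz), fun z hz => hle.trans (hr.le.trans (hn y z hz))⟩
  obtain ⟨u, v, huv⟩ := exists_pair_ne Y
  obtain ⟨a, b, hab, -⟩ := exists_areTwins huv
  have hinj : Set.InjOn (fun x => dist x (n x)) (univ.erase a : Finset Y) := by
    intro x hx y hy hr
    by_contra hxy
    have hx' : x ≠ a := by simpa using hx
    have hy' : y ≠ a := by simpa using hy
    rcases Sym2.eq_iff.1 ((twins x y hxy hr).sym2_eq hY hab) with ⟨h, -⟩ | ⟨-, h⟩
    exacts [hx' h, hy' h]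
  have hzero : (0 : ℝ) ∉ (univ.erase a).image fun x => dist x (n x) := by
    simp only [mem_image, not_exists, not_and]
    exact fun x _ => dist_ne_zero.2 (hne x).symm
  have hsub : ((insert 0 ((univ.erase a).image fun x => dist x (n x)) : Finset ℝ) : Set ℝ) ⊆
      metricSpectrum Y := by
    intro r hr
    simp only [mem_coe, mem_insert, mem_image] at hr
    rcases hr with rfl | ⟨x, -, rfl⟩
    · exact ⟨a, a, dist_self a⟩
    · exact ⟨x, n x, rfl⟩
  have hle := Set.ncard_le_ncard hsub (finite_metricSpectrum Y)
  rw [Set.ncard_coe_finset, card_insert_of_notMem hzero, card_image_of_injOn hinj,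
    card_erase_of_mem (mem_univ a), card_univ] at hle
  omega

/-- If `X` and `Y` are finite ultrametric spaces with
`|X| = |Y| ≥ 2` and `Y ∈ ℜ`, then `|Sp(X)| ≤ |Sp(Y)|`. -/
theorem stmt7 (X : Type*) [MetricSpace X] [IsUltrametricDist X] [Fintype X]
    (Y : Type*) [MetricSpace Y] [IsUltrametricDist Y] [Fintype Y]
    (hcard : Fintype.card X = Fintype.card Y) (h2 : 2 ≤ Fintype.card X)
    (hY : maxRigid Y) :
    (metricSpectrum X).ncard ≤ (metricSpectrum Y).ncard := by
  have : Nontrivial Y := Fintype.one_lt_card_iff_nontrivial.1 (hcard ▸ h2)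
  exact (ncard_metricSpectrum_le_card X).trans (hcard.le.trans (card_le_ncard_metricSpectrum hY))
end

section
/- Let (X,d) be a finite ultrametric space with |X| ≥ 2. Then X ∈ ℜ if and only if for every positive r ∈ Sp(X) the graph G'_{r,X} (the subgraph of G_{r,X} induced on its non-isolated vertices) is a star whose vertex set is a ball of X of diameter r; that is, there exist a point c ∈ X and a ball B ∈ B_X with c ∈ B and diam B = r such that the pairs {x,y} of distinct points of X with d(x,y) = r are exactly the pairs {c,b} with b ∈ B, b ≠ c. -/
/-- Two distinct points which are equidistant from every other point. -/
def IsTwinPair {X : Type*} [MetricSpace X] (x y : X) : Prop :=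
  x ≠ y ∧ ∀ z, z ≠ x → z ≠ y → dist x z = dist y z

section TwinPairs

variable {X : Type*} [MetricSpace X]

open Classical in
theorem IsTwinPair.dist_swap {x y : X} (h : IsTwinPair x y) (u v : X) :
    dist (Equiv.swap x y u) (Equiv.swap x y v) = dist u v := by
  have hcomm := dist_comm x y
  have key := h.2
  rcases eq_or_ne u v with rfl | huv
  · simp
  rw [Equiv.swap_apply_def, Equiv.swap_apply_def]
  split_ifs <;> subst_vars <;> first
    | rfl
    | exact absurd rfl huv
    | exact dist_comm _ _
    | exact (key _ ‹_› ‹_›).symm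
    | exact key _ ‹_› ‹_›
    | (rw [dist_comm u, dist_comm u]; first
        | exact (key _ ‹_› ‹_›).symm
        | exact key _ ‹_› ‹_›)

/-- In an ultrametric space, mutually nearest points form a twin pair. -/
theorem isTwinPair_of_dist_le [IsUltrametricDist X] {x y : X} (hxy : x ≠ y)
    (hx : ∀ z, z ≠ x → dist x y ≤ dist x z) (hy : ∀ z, z ≠ y → dist x y ≤ dist y z) :
    IsTwinPair x y := by
  refine ⟨hxy, fun z hzx hzy => le_antisymm ?_ ?_⟩
  · exact (IsUltrametricDist.dist_triangle_max x y z).trans (max_le (hy z hzy) le_rfl)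
  · refine (IsUltrametricDist.dist_triangle_max y x z).trans (max_le ?_ le_rfl)
    rw [dist_comm]
    exact hx z hzx

/-- Every nontrivial closed ball of a finite ultrametric space contains a twin pair. -/
theorem exists_isTwinPair_dist_le [IsUltrametricDist X] [Finite X] {p q : X} (hpq : p ≠ q) :
    ∃ x y, IsTwinPair x y ∧ dist p x ≤ dist p q ∧ dist p y ≤ dist p q := by
  obtain ⟨⟨x, y⟩, ⟨hxy, hx, hy⟩, hmin⟩ := Set.exists_min_image
    {e : X × X | e.1 ≠ e.2 ∧ dist p e.1 ≤ dist p q ∧ dist p e.2 ≤ dist p q}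
    (fun e => dist e.1 e.2) (Set.toFinite _)
    ⟨(p, q), hpq, by simp, le_rfl⟩
  dsimp only at hxy hx hy hmin
  have hr : dist x y ≤ dist p q :=
    (IsUltrametricDist.dist_triangle_max x p y).trans (max_le (by rwa [dist_comm]) hy)
  have near : ∀ u, dist p u ≤ dist p q → ∀ z, z ≠ u → dist x y ≤ dist u z := by
    intro u hu z hz
    by_cases h : dist u z ≤ dist p q
    · exact hmin (u, z) ⟨hz.symm, hu,
        (IsUltrametricDist.dist_triangle_max p u z).trans (max_le hu h)⟩
    · exact hr.trans (not_le.mp h).le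
  exact ⟨x, y, isTwinPair_of_dist_le hxy (near x hx) (near y hy), hx, hy⟩

end TwinPairs

section MaxRigid

variable {X : Type*} [MetricSpace X]

/-- A self-isometry of a space in `ℜ` cannot move three distinct points. -/
theorem maxRigid.fixes_one_of_three [Finite X] (h : maxRigid X) {g : X → X}
    (hs : Function.Surjective g) (hg : ∀ x y : X, dist (g x) (g y) = dist x y) {x y z : X}
    (hxy : x ≠ y) (hxz : x ≠ z) (hyz : y ≠ z) : g x = x ∨ g y = y ∨ g z = z := by
  by_contra! hne
  obtain ⟨hx, hy, hz⟩ := hne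
  have hsub : ({x, y, z} : Set X) ⊆ {w | g w = w}ᶜ := by
    rintro w (rfl | rfl | rfl) <;> assumption
  have h3 : ({x, y, z} : Set X).ncard = 3 := Set.ncard_eq_three.mpr ⟨x, y, z, hxy, hxz, hyz, rfl⟩
  have hle := Set.ncard_le_ncard hsub (Set.toFinite _)
  have hadd := Set.ncard_add_ncard_compl {w | g w = w}
  have := h g hs hg
  omega

/-- In a space in `ℜ` any two twin pairs coincide. -/
theorem maxRigid.mem_of_isTwinPair [Finite X] (h : maxRigid X) {a b x y : X}
    (hab : IsTwinPair a b) (hxy : IsTwinPair x y) : a = x ∨ a = y := by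
  classical
  by_contra! hne
  obtain ⟨hax, hay⟩ := hne
  have hba := hab.1
  have hne' := hxy.1
  have := h.fixes_one_of_three (g := fun u => Equiv.swap a b (Equiv.swap x y u))
    ((Equiv.swap a b).surjective.comp (Equiv.swap x y).surjective)
    (fun u v => by rw [hab.dist_swap, hxy.dist_swap]) hax hay hne'
  simp only [Equiv.swap_apply_left, Equiv.swap_apply_right,
    Equiv.swap_apply_of_ne_of_ne hax hay] at this
  rw [Equiv.swap_apply_def a b x, Equiv.swap_apply_def a b y] at this
  grind

/-- A space in `ℜ` has a point which belongs to every nontrivial ball, and the distances from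
this point determine the other points. -/
theorem maxRigid.exists_root [IsUltrametricDist X] [Finite X] [Nontrivial X] (h : maxRigid X) :
    ∃ a : X, (∀ x y, x ≠ y → dist x a ≤ dist x y) ∧
      ∀ x y, x ≠ a → y ≠ a → dist x a = dist y a → x = y := by
  obtain ⟨p, q, hpq⟩ := exists_pair_ne X
  obtain ⟨a, b, hab, -, -⟩ := exists_isTwinPair_dist_le hpq
  have root : ∀ x y, x ≠ y → dist x a ≤ dist x y := by
    intro x y hxy
    obtain ⟨u, v, huv, hu, hv⟩ := exists_isTwinPair_dist_le hxy
    rcases h.mem_of_isTwinPair hab huv with rfl | rfl <;> assumption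
  refine ⟨a, root, fun x y hx hy he => ?_⟩
  by_contra hxy
  have hle : dist x y ≤ dist x a :=
    (IsUltrametricDist.dist_triangle_max x a y).trans (by rw [dist_comm a y, ← he, max_self])
  have htwin : IsTwinPair x y := isTwinPair_of_dist_le hxy
    (fun z hz => hle.trans (root x z hz.symm))
    (fun z hz => (hle.trans he.le).trans (root y z hz.symm))
  rcases h.mem_of_isTwinPair hab htwin with rfl | rfl <;> contradiction

theorem maxRigid.exists_star [IsUltrametricDist X] [Finite X] (h : maxRigid X)
    {r : ℝ} (hr : r ∈ metricSpectrum X) (hpos : 0 < r) :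
    ∃ c : X, ∃ B ∈ metricBalls X, c ∈ B ∧ Metric.diam B = r ∧
      ∀ x y : X, x ≠ y →
        (dist x y = r ↔
          (x = c ∧ y ∈ B ∧ y ≠ c) ∨ (y = c ∧ x ∈ B ∧ x ≠ c)) := by
  obtain ⟨u, v, huv⟩ := hr
  have hne : u ≠ v := dist_pos.mp (huv ▸ hpos)
  have : Nontrivial X := ⟨u, v, hne⟩
  obtain ⟨a, root, inj⟩ := h.exists_root
  have near : ∀ x y, dist x y = r → dist x a ≤ r ∧ dist y a ≤ r := by
    intro x y hxy
    have hxy' : x ≠ y := dist_pos.mp (hxy ▸ hpos)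
    have h1 := root x y hxy'
    have h2 := root y x hxy'.symm
    rw [dist_comm y x] at h2
    exact ⟨h1.trans hxy.le, h2.trans hxy.le⟩
  have far : ∀ x y, dist x y = r → dist x a = r ∨ dist y a = r := by
    intro x y hxy
    obtain ⟨h1, h2⟩ := near x y hxy
    have h3 := IsUltrametricDist.dist_triangle_max x a y
    rw [hxy, dist_comm a y] at h3
    exact (le_max_iff.mp h3).imp h1.antisymm h2.antisymm
  obtain ⟨c, hc⟩ : ∃ c, dist c a = r := (far u v huv).elim (⟨u, ·⟩) (⟨v, ·⟩)
  have hca : c ≠ a := dist_pos.mp (hc ▸ hpos)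
  have eq_c : ∀ x, dist x a = r → x = c := fun x hx =>
    inj x c (dist_pos.mp (hx ▸ hpos)) hca (hx.trans hc.symm)
  have dist_c : ∀ y, dist y a ≤ r → y ≠ c → dist c y = r := by
    intro y hy hyc
    refine le_antisymm ?_ (hc ▸ root c y hyc.symm)
    exact (IsUltrametricDist.dist_triangle_max c a y).trans
      (max_le hc.le (by rwa [dist_comm]))
  refine ⟨c, {x | dist x a ≤ r}, ⟨a, r, hpos.le, rfl⟩, hc.le, le_antisymm ?_ ?_, ?_⟩
  · refine Metric.diam_le_of_forall_dist_le hpos.le fun x hx y hy => ?_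
    exact (IsUltrametricDist.dist_triangle_max x a y).trans
      (max_le hx (by rw [dist_comm]; exact hy))
  · have hmem : a ∈ {x | dist x a ≤ r} := by simp [hpos.le]
    have := Metric.dist_le_diam_of_mem (Set.toFinite {x | dist x a ≤ r}).isBounded
      (show c ∈ {x | dist x a ≤ r} from hc.le) hmem
    rwa [hc] at this
  · intro x y hxy
    constructor
    · intro hd
      obtain ⟨hx, hy⟩ := near x y hd
      rcases far x y hd with h1 | h1
      · obtain rfl := eq_c x h1
        exact Or.inl ⟨rfl, hy, hxy.symm⟩
      · obtain rfl := eq_c y h1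
        exact Or.inr ⟨rfl, hx, hxy⟩
    · rintro (⟨rfl, hy, hyc⟩ | ⟨rfl, hx, hxc⟩)
      · exact dist_c y hy hyc
      · rw [dist_comm]
        exact dist_c x hx hxc

/-- If the pairs of points at any given positive distance share a common point, then the space
belongs to `ℜ`. -/
theorem maxRigid_of_exists_center [Finite X]
    (h : ∀ r : ℝ, 0 < r → ∃ c : X, ∀ x y : X, dist x y = r → x = c ∨ y = c) : maxRigid X := by
  intro g _ hg
  have ginj : Function.Injective g := fun x y hxy => by
    rw [← dist_eq_zero, ← hg, hxy, dist_self]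
  have moved : ∀ x y, x ≠ y → g x ≠ x → g y ≠ y → g x = y ∨ g y = x := by
    intro x y hxy hx hy
    obtain ⟨c, hc⟩ := h _ (dist_pos.mpr hxy)
    have h1 := hc x y rfl
    have h2 := hc (g x) (g y) (hg x y)
    grind
  have cyc : ∀ x y z, x ≠ y → x ≠ z → y ≠ z → g x = y → g y = z → g z = x → False := by
    intro x y z hxy hxz hyz h1 h2 h3
    obtain ⟨c, hc⟩ := h _ (dist_pos.mpr hxy)
    have e1 : dist y z = dist x y := by rw [← hg x y, h1, h2]
    have e2 : dist z x = dist x y := by rw [← e1, ← hg y z, h2, h3]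
    have := hc x y rfl
    have := hc y z e1
    have := hc z x e2
    grind
  have hle : {x | g x = x}ᶜ.ncard ≤ 2 := by
    by_contra! hlt
    obtain ⟨x, hx, y, hy, z, hz, hxy, hxz, hyz⟩ := (Set.two_lt_ncard (Set.toFinite _)).mp hlt
    simp only [Set.mem_compl_iff, Set.mem_ofPred_eq] at hx hy hz
    have m1 := moved x y hxy hx hy
    have m2 := moved y z hyz hy hz
    have m3 := moved x z hxz hx hz
    have i1 := @ginj x y
    have i2 := @ginj y z
    have i3 := @ginj x z
    have c1 := cyc x y z hxy hxz hyz
    have c2 := cyc x z y hxz hxy hyz.symm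
    grind
  have hadd := Set.ncard_add_ncard_compl {x | g x = x}
  omega

end MaxRigid

/-- A finite ultrametric space `X` with `|X| ≥ 2` belongs to
`ℜ` if and only if for every positive `r ∈ Sp(X)` the graph `G'_{r,X}` is a
star whose vertex set is a ball of diameter `r`: there are `c ∈ X` and a ball
`B` with `c ∈ B` and `diam B = r` such that the pairs of distinct points of
`X` at distance `r` are exactly the pairs `{c, b}` with `b ∈ B`, `b ≠ c`. -/
theorem stmt9 (X : Type*) [MetricSpace X] [IsUltrametricDist X] [Fintype X]
    (hcard : 2 ≤ Fintype.card X) :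
    maxRigid X ↔
      ∀ r ∈ metricSpectrum X, 0 < r →
        ∃ c : X, ∃ B ∈ metricBalls X, c ∈ B ∧ Metric.diam B = r ∧
          ∀ x y : X, x ≠ y →
            (dist x y = r ↔
              (x = c ∧ y ∈ B ∧ y ≠ c) ∨ (y = c ∧ x ∈ B ∧ x ≠ c)) := by
  have : Nontrivial X := Fintype.one_lt_card_iff_nontrivial.mp hcard
  refine ⟨fun h r hr hpos => h.exists_star hr hpos, fun h => maxRigid_of_exists_center ?_⟩
  intro r hpos
  by_cases hr : r ∈ metricSpectrum X
  · obtain ⟨c, B, -, -, -, hB⟩ := h r hr hpos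
    refine ⟨c, fun x y hxy => ?_⟩
    rcases (hB x y (dist_pos.mp (hxy ▸ hpos))).mp hxy with hx | hy
    · exact Or.inl hx.1
    · exact Or.inr hy.1
  · obtain ⟨c⟩ := (inferInstance : Nonempty X)
    exact ⟨c, fun x y hxy => absurd ⟨x, y, hxy⟩ hr⟩
end

section
/- Let (X,d) be a finite ultrametric space with n = |X| ≥ 2. Then the following are equivalent: (i) X ∈ ℜ; (ii) there is an enumeration x_1, …, x_n of all points of X such that d(x_k, x_{k+1}) > d(x_{k+1}, x_{k+2}) for every k = 1, …, n−2; (iii) there are a point y_0 ∈ X and an enumeration y_1, …, y_{n−1} of the remaining points of X such that the distances d(y_0, y_1), …, d(y_0, y_{n−1}) are pairwise distinct. -/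
section UltrametricRigidity

variable {X : Type*} [MetricSpace X] [IsUltrametricDist X]

/-- In an ultrametric triangle, the two sides that are at least as long as the third agree. -/
theorem dist_eq_of_dist_le_of_dist_le {a b z : X} (ha : dist a b ≤ dist a z)
    (hb : dist a b ≤ dist b z) : dist a z = dist b z := by
  apply le_antisymm
  · exact (IsUltrametricDist.dist_triangle_max a b z).trans (max_le hb le_rfl)
  · refine (IsUltrametricDist.dist_triangle_max b a z).trans (max_le ?_ le_rfl)
    rwa [dist_comm b a]

/-- If one ultrametric side is strictly shorter than another, the remaining side equals the
longer one. -/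
theorem dist_eq_of_dist_lt {a b c : X} (h : dist b c < dist a b) : dist a c = dist a b := by
  apply le_antisymm
  · exact (IsUltrametricDist.dist_triangle_max a b c).trans (max_le le_rfl h.le)
  · rcases le_max_iff.1 (IsUltrametricDist.dist_triangle_max a c b) with h' | h'
    · exact h'
    · rw [dist_comm c b] at h'
      exact absurd h (not_lt.2 h')

/-- Swapping two points that have equal distances to all other points is an isometry. -/
theorem dist_swap_swap {X : Type*} [MetricSpace X] [DecidableEq X] {u v : X}
    (h : ∀ z, z ≠ u → z ≠ v → dist u z = dist v z) (x y : X) :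
    dist (Equiv.swap u v x) (Equiv.swap u v y) = dist x y := by
  have h' : ∀ z, z ≠ u → z ≠ v → dist z u = dist z v := fun z hu hv ↦ by
    rw [dist_comm z u, dist_comm z v, h z hu hv]
  simp only [Equiv.swap_apply_def]
  split_ifs <;> simp_all [dist_comm]

/-- If the distances from `y₀` to the other points are pairwise distinct, then `y₀` is a
nearest point of every other point. -/
theorem dist_le_of_injOn_dist {y₀ : X}
    (h : ∀ u v : X, u ≠ y₀ → v ≠ y₀ → dist y₀ u = dist y₀ v → u = v)
    {z w : X} (hz : z ≠ y₀) (hw : w ≠ z) : dist y₀ z ≤ dist z w := by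
  by_contra! hlt
  have hw₀ : w ≠ y₀ := by
    rintro rfl
    rw [dist_comm] at hlt
    exact lt_irrefl _ hlt
  exact hw (h w z hw₀ hz (dist_eq_of_dist_lt hlt))

theorem maxRigid_of_injOn_dist [Finite X] {y₀ : X}
    (h : ∀ u v : X, u ≠ y₀ → v ≠ y₀ → dist y₀ u = dist y₀ v → u = v) : maxRigid X := by
  intro g hg hd
  have hinj : Function.Injective g := fun x y hxy ↦ by
    rw [← dist_eq_zero, ← hd, hxy, dist_self]
  obtain ⟨w, hw⟩ := hg y₀
  have hfix : ({y₀, w} : Set X)ᶜ ⊆ {x : X | g x = x} := by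
    intro z hz
    simp only [Set.mem_compl_iff, Set.mem_insert_iff, Set.mem_singleton_iff, not_or] at hz
    have hgz : g z ≠ y₀ := fun e ↦ hz.2 (hinj (e.trans hw.symm))
    refine h _ _ hgz hz.1 (le_antisymm ?_ ?_)
    · have := dist_le_of_injOn_dist h hgz (hinj.ne (Ne.symm hz.1))
      rwa [hd, dist_comm z] at this
    · have := dist_le_of_injOn_dist h hz.1 (Ne.symm hz.2)
      rwa [← hd z, hw, dist_comm (g z)] at this
  have h₁ := Set.ncard_le_ncard hfix
  have h₂ := Set.ncard_add_ncard_compl ({y₀, w} : Set X)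
  have h₃ := Set.ncard_insert_le y₀ {w}
  rw [Set.ncard_singleton] at h₃
  omega

theorem exists_injOn_dist_of_maxRigid [Finite X] [Nontrivial X] (h : maxRigid X) :
    ∃ y₀ : X, ∀ u v : X, u ≠ y₀ → v ≠ y₀ → dist y₀ u = dist y₀ v → u = v := by
  classical
  obtain ⟨⟨a, b⟩, hab, hmin⟩ := Set.exists_min_image {p : X × X | p.1 ≠ p.2}
    (fun p ↦ dist p.1 p.2) (Set.toFinite _) (by
      obtain ⟨x, y, hxy⟩ := exists_pair_ne X
      exact ⟨(x, y), hxy⟩)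
  have hswap_ab : ∀ z, z ≠ a → z ≠ b → dist a z = dist b z := fun z ha hb ↦
    dist_eq_of_dist_le_of_dist_le (hmin (a, z) ha.symm) (hmin (b, z) hb.symm)
  refine ⟨a, fun u₀ v₀ hu₀ hv₀ he ↦ ?_⟩
  by_contra hne₀
  obtain ⟨⟨u, v⟩, ⟨hne, hu, hv⟩, hmin'⟩ := Set.exists_min_image
    {p : X × X | p.1 ≠ p.2 ∧ dist a p.1 = dist a u₀ ∧ dist a p.2 = dist a u₀}
    (fun p ↦ dist p.1 p.2) (Set.toFinite _) ⟨(u₀, v₀), hne₀, rfl, he.symm⟩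
  dsimp only at hne hu hv hmin' hab
  have hpos : 0 < dist a u₀ := dist_pos.2 hu₀.symm
  have hua : u ≠ a := by
    rintro rfl
    rw [dist_self] at hu
    exact hpos.ne hu
  have hva : v ≠ a := by
    rintro rfl
    rw [dist_self] at hv
    exact hpos.ne hv
  have hswap_uv : ∀ z, z ≠ u → z ≠ v → dist u z = dist v z := by
    intro z hzu hzv
    by_cases hz : dist a z = dist a u₀
    · exact dist_eq_of_dist_le_of_dist_le (hmin' (u, z) ⟨hzu.symm, hu, hz⟩)
        (hmin' (v, z) ⟨hzv.symm, hv, hz⟩)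
    · have key : ∀ t, dist a t = dist a u₀ → dist t z = max (dist t a) (dist a z) :=
        fun t ht ↦ IsUltrametricDist.dist_eq_max_of_dist_ne_dist t a z
          (by rw [dist_comm, ht]; exact Ne.symm hz)
      rw [key u hu, key v hv, dist_comm u, dist_comm v, hu, hv]
  set g : Equiv.Perm X := Equiv.swap a b * Equiv.swap u v with hg
  have hfix := h g g.surjective fun x y ↦ by
    simp only [hg, Equiv.Perm.mul_apply, dist_swap_swap hswap_ab, dist_swap_swap hswap_uv]
  have hsub : {x : X | g x = x} ⊆ ({a, u, v} : Set X)ᶜ := by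
    intro x hx hmem
    simp only [Set.mem_insert_iff, Set.mem_singleton_iff] at hmem
    simp only [Set.mem_ofPred_eq, hg, Equiv.Perm.mul_apply] at hx
    rcases hmem with rfl | rfl | rfl
    · rw [Equiv.swap_apply_of_ne_of_ne hua.symm hva.symm, Equiv.swap_apply_left] at hx
      exact hab hx.symm
    · rw [Equiv.swap_apply_left, Equiv.swap_apply_def] at hx
      split_ifs at hx <;> simp_all
    · rw [Equiv.swap_apply_right, Equiv.swap_apply_def] at hx
      split_ifs at hx <;> simp_all
  have h₁ := Set.ncard_le_ncard hsub
  have h₂ := Set.ncard_add_ncard_compl ({a, u, v} : Set X)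
  have h₃ : ({a, u, v} : Set X).ncard = 3 :=
    Set.ncard_eq_three.2 ⟨a, u, v, hua.symm, hva.symm, hne, rfl⟩
  omega

theorem dist_eq_dist_succ_of_strictAnti {n : ℕ} {p : ℕ → X}
    (hp : ∀ k, k + 2 < n → dist (p (k + 1)) (p (k + 2)) < dist (p k) (p (k + 1))) (j k : ℕ)
    (hk : k + j + 1 < n) : dist (p k) (p (k + j + 1)) = dist (p k) (p (k + 1)) := by
  induction j generalizing k with
  | zero => rfl
  | succ j ih =>
    have h := ih (k + 1) (by omega)
    rw [show k + (j + 1) + 1 = k + 1 + j + 1 by omega]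
    refine dist_eq_of_dist_lt ?_
    rw [h]
    exact hp k (by omega)

theorem injOn_dist_of_strictAnti {n : ℕ} {p : ℕ → X}
    (hp : ∀ k, k + 2 < n → dist (p (k + 1)) (p (k + 2)) < dist (p k) (p (k + 1))) {i j : ℕ}
    (hi : i + 1 < n) (hj : j + 1 < n)
    (h : dist (p (n - 1)) (p i) = dist (p (n - 1)) (p j)) : i = j := by
  have hlt : ∀ d k, k + d + 2 < n →
      dist (p (k + d + 1)) (p (k + d + 2)) < dist (p k) (p (k + 1)) := by
    intro d k
    induction d with
    | zero => exact hp k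
    | succ d ih => exact fun hk ↦ (hp (k + d + 1) hk).trans (ih (by omega))
  have hlast : ∀ k, k + 1 < n → dist (p (n - 1)) (p k) = dist (p k) (p (k + 1)) := by
    intro k hk
    rw [dist_comm, ← dist_eq_dist_succ_of_strictAnti hp (n - 2 - k) k (by omega),
      show k + (n - 2 - k) + 1 = n - 1 by omega]
  rw [hlast i hi, hlast j hj] at h
  rcases lt_trichotomy i j with hij | hij | hij
  · obtain ⟨d, rfl⟩ := Nat.exists_eq_add_of_lt hij
    exact absurd h (hlt d i hj).ne'
  · exact hij
  · obtain ⟨d, rfl⟩ := Nat.exists_eq_add_of_lt hij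
    exact absurd h (hlt d j hi).ne

theorem exists_injOn_dist_of_enumeration {n : ℕ} (hn : 2 ≤ n) {x : Fin n → X}
    (hx : Function.Surjective x)
    (hlt : ∀ i j k : Fin n, (i : ℕ) + 1 = j → (j : ℕ) + 1 = k →
      dist (x j) (x k) < dist (x i) (x j)) :
    ∃ y₀ : X, ∀ u v : X, u ≠ y₀ → v ≠ y₀ → dist y₀ u = dist y₀ v → u = v := by
  set p : ℕ → X := fun k ↦ if hk : k < n then x ⟨k, hk⟩ else x ⟨0, by omega⟩
  have hpx : ∀ k (hk : k < n), p k = x ⟨k, hk⟩ := fun k hk ↦ dif_pos hk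
  have hp : ∀ k, k + 2 < n → dist (p (k + 1)) (p (k + 2)) < dist (p k) (p (k + 1)) := by
    intro k hk
    rw [hpx k (by omega), hpx (k + 1) (by omega), hpx (k + 2) hk]
    exact hlt _ _ _ rfl rfl
  refine ⟨p (n - 1), fun u v hu hv huv ↦ ?_⟩
  obtain ⟨⟨i, hi⟩, rfl⟩ := hx u
  obtain ⟨⟨j, hj⟩, rfl⟩ := hx v
  rw [← hpx i hi] at hu huv ⊢
  rw [← hpx j hj] at hv huv ⊢
  have hi' : i ≠ n - 1 := fun e ↦ hu (congrArg p e)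
  have hj' : j ≠ n - 1 := fun e ↦ hv (congrArg p e)
  exact congrArg p (injOn_dist_of_strictAnti hp (by omega) (by omega) huv)

theorem exists_enumeration_of_injOn_dist [Fintype X] {n : ℕ} (hn : n = Fintype.card X) {y₀ : X}
    (h : ∀ u v : X, u ≠ y₀ → v ≠ y₀ → dist y₀ u = dist y₀ v → u = v) :
    ∃ x : Fin n → X, Function.Bijective x ∧
      ∀ i j k : Fin n, i < j → j < k → dist (x j) (x k) < dist (x i) (x j) := by
  have hinj : Function.Injective fun z ↦ -dist y₀ z := by
    intro u v huv
    have huv : dist y₀ u = dist y₀ v := neg_injective huv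
    by_cases hu : u = y₀
    · rw [hu, dist_self] at huv
      rw [hu, dist_eq_zero.1 huv.symm]
    by_cases hv : v = y₀
    · rw [hv, dist_self] at huv
      rw [hv, dist_eq_zero.1 huv]
    exact h u v hu hv huv
  let e : Fin n ≃ X := (Fintype.equivFinOfCardEq hn.symm).symm
  let f : Fin n → ℝ := fun i ↦ -dist y₀ (e i)
  let x : Fin n ≃ X := (Tuple.sort f).trans e
  have hmono : StrictMono fun i ↦ -dist y₀ (x i) :=
    (Tuple.monotone_sort f).strictMono_of_injective (hinj.comp x.injective)
  have hanti : ∀ i j, i < j → dist y₀ (x j) < dist y₀ (x i) := fun i j hij ↦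
    neg_lt_neg_iff.1 (hmono hij)
  have hdist : ∀ i j, i < j → dist (x i) (x j) = dist y₀ (x i) := by
    intro i j hij
    have hij := hanti i j hij
    rw [dist_comm y₀ (x i)] at hij ⊢
    exact dist_eq_of_dist_lt hij
  refine ⟨x, x.bijective, fun i j k hij hjk ↦ ?_⟩
  rw [hdist _ _ hij, hdist _ _ hjk]
  exact hanti _ _ hij

end UltrametricRigidity

/-- For a finite ultrametric space `X` with `n = |X| ≥ 2`,
the following are equivalent: (i) `X ∈ ℜ`; (ii) there is an enumeration
`x_1, …, x_n` of `X` with strictly decreasing consecutive distances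
(`d(x_k, x_{k+1}) > d(x_{k+1}, x_{k+2})`); (iii) there is a point `y₀` such
that the distances from `y₀` to the remaining points are pairwise distinct. -/
theorem stmt14 (X : Type*) [MetricSpace X] [IsUltrametricDist X] [Fintype X]
    (n : ℕ) (hn : n = Fintype.card X) (hcard : 2 ≤ n) :
    (maxRigid X ↔
      ∃ x : Fin n → X, Function.Bijective x ∧
        ∀ k : ℕ, (hk : k + 2 < n) →
          dist (x ⟨k + 1, by omega⟩) (x ⟨k + 2, by omega⟩) <
            dist (x ⟨k, by omega⟩) (x ⟨k + 1, by omega⟩)) ∧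
    (maxRigid X ↔
      ∃ y₀ : X, ∀ u v : X, u ≠ y₀ → v ≠ y₀ → dist y₀ u = dist y₀ v → u = v) := by
  have : Nontrivial X := Fintype.one_lt_card_iff_nontrivial.1 (by omega)
  have hiii : maxRigid X ↔
      ∃ y₀ : X, ∀ u v : X, u ≠ y₀ → v ≠ y₀ → dist y₀ u = dist y₀ v → u = v :=
    ⟨exists_injOn_dist_of_maxRigid, fun ⟨_, h⟩ ↦ maxRigid_of_injOn_dist h⟩
  refine ⟨hiii.trans ⟨?_, ?_⟩, hiii⟩
  · rintro ⟨y₀, h⟩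
    obtain ⟨x, hx, hlt⟩ := exists_enumeration_of_injOn_dist hn h
    exact ⟨x, hx, fun k hk ↦
      hlt _ _ _ (Fin.mk_lt_mk.2 k.lt_succ_self) (Fin.mk_lt_mk.2 (k + 1).lt_succ_self)⟩
  · rintro ⟨x, hx, hlt⟩
    refine exists_injOn_dist_of_enumeration hcard hx.surjective ?_
    rintro ⟨i, _⟩ ⟨_, _⟩ ⟨_, hk⟩ rfl rfl
    exact hlt i hk
end

section
/- Let X be a finite set with |X| ≥ 2, let c ∈ X, and let w : X \ {c} → ℝ be a function with w(x) > 0 for all x. Then the following are equivalent: (1) there is exactly one function d : X × X → ℝ that is an ultrametric on X (i.e., d is symmetric, d(x,y) = 0 iff x = y, and d(x,y) ≤ max{d(x,z), d(z,y)} for all x,y,z) and satisfies d(c,x) = w(x) for every x ∈ X \ {c}; (2) the function w is injective. -/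
/-- A function `d : X → X → ℝ` is an ultrametric on `X` if it is symmetric,
vanishes exactly on the diagonal, and satisfies the strong triangle
inequality. -/
def IsUltrametricOn {X : Type*} (d : X → X → ℝ) : Prop :=
  (∀ x y : X, d x y = d y x) ∧ (∀ x y : X, d x y = 0 ↔ x = y) ∧
    ∀ x y z : X, d x y ≤ max (d x z) (d z y)

open Classical in
/-- Extend a nonnegative height function `W` to distances: distinct points at different heights are
at the larger height apart, distinct points at a common height `r` are at distance `t * r`. -/
noncomputable def heightDist {X : Type*} (W : X → ℝ) (t : ℝ) (x y : X) : ℝ :=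
  if x = y then 0 else if W x = W y then t * W x else max (W x) (W y)

theorem isUltrametricOn_heightDist {X : Type*} {W : X → ℝ} {c : X} (hc : W c = 0)
    (hW : ∀ x, x ≠ c → 0 < W x) {t : ℝ} (ht : 0 < t) (ht1 : t ≤ 1) :
    IsUltrametricOn (heightDist W t) := by
  have hnn : ∀ x, 0 ≤ W x := fun x => by
    by_cases h : x = c
    · rw [h, hc]
    · exact (hW x h).le
  have hle : ∀ x, t * W x ≤ W x := fun x => mul_le_of_le_one_left (hnn x) ht1
  have htn : ∀ x, 0 ≤ t * W x := fun x => mul_nonneg ht.le (hnn x)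
  refine ⟨fun x y => ?_, fun x y => ?_, fun x y z => ?_⟩
  · unfold heightDist
    grind
  · refine ⟨fun h => ?_, fun h => by simp [heightDist, h]⟩
    by_contra hxy
    have hpos : 0 < W x ∨ 0 < W y := by
      by_cases hx : x = c
      · exact Or.inr (hW y fun hy => hxy (hx.trans hy.symm))
      · exact Or.inl (hW x hx)
    simp only [heightDist, if_neg hxy] at h
    split_ifs at h with hW'
    · have : 0 < W x := by grind
      exact (mul_pos ht this).ne' h
    · grind
  · have := hnn x
    have := hnn y
    have := hnn z
    have := hle x
    have := hle y
    have := hle z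
    have := htn x
    have := htn y
    have := htn z
    unfold heightDist
    grind

theorem heightDist_center {X : Type*} {W : X → ℝ} {c : X} (hc : W c = 0)
    (hW : ∀ x, x ≠ c → 0 < W x) (t : ℝ) {x : X} (hx : x ≠ c) :
    heightDist W t c x = W x := by
  have h := hW x hx
  rw [heightDist, if_neg hx.symm, if_neg (hc ▸ h.ne), hc, max_eq_right h.le]

/-- In an ultrametric space, every triangle is isosceles with its two largest sides equal. -/
theorem IsUltrametricOn.eq_max_of_ne {X : Type*} {d : X → X → ℝ} (hd : IsUltrametricOn d)
    {c x y : X} (h : d c x ≠ d c y) : d x y = max (d c x) (d c y) := by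
  obtain ⟨hs, -, ht⟩ := hd
  have h1 := ht x y c
  have h2 := ht c x y
  have h3 := ht c y x
  rw [hs x c] at h1
  rw [hs y x] at h2
  grind

/-- Let `X` be a finite set with `|X| ≥ 2`, let `c ∈ X`, and
let `w` assign a positive weight to every point other than `c` (a weighted
star centered at `c`).  Then there is exactly one ultrametric `d` on `X` with
`d(c, x) = w x` for all `x ≠ c` if and only if `w` is injective on
`X \ {c}`. -/
theorem stmt16 (X : Type*) [Fintype X] (hcard : 2 ≤ Fintype.card X)
    (c : X) (w : X → ℝ) (hw : ∀ x : X, x ≠ c → 0 < w x) :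
    (∃! d : X → X → ℝ, IsUltrametricOn d ∧ ∀ x : X, x ≠ c → d c x = w x) ↔
      Set.InjOn w {x : X | x ≠ c} := by
  classical
  set W : X → ℝ := fun x => if x = c then 0 else w x with hWdef
  have hc : W c = 0 := by simp [hWdef]
  have hWw : ∀ x, x ≠ c → W x = w x := fun x hx => by simp [hWdef, hx]
  have hW : ∀ x, x ≠ c → 0 < W x := fun x hx => hWw x hx ▸ hw x hx
  have hext : ∀ t : ℝ, 0 < t → t ≤ 1 →
      IsUltrametricOn (heightDist W t) ∧ ∀ x, x ≠ c → heightDist W t c x = w x :=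
    fun t ht ht1 => ⟨isUltrametricOn_heightDist hc hW ht ht1,
      fun x hx => (heightDist_center hc hW t hx).trans (hWw x hx)⟩
  constructor
  · intro hu a ha b hb hab
    by_contra hne
    have heq := hu.unique (hext 1 one_pos le_rfl) (hext (1 / 2) (by norm_num) (by norm_num))
    have hWab : W a = W b := by rw [hWw a ha, hWw b hb, hab]
    have h := congrFun (congrFun heq a) b
    simp only [heightDist, if_neg hne, if_pos hWab] at h
    linarith [hW a ha]
  · intro hinj
    refine ⟨heightDist W 1, hext 1 one_pos le_rfl, fun d hd => ?_⟩
    obtain ⟨hd, hdw⟩ := hd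
    have hdW : ∀ x, d c x = W x := fun x => by
      by_cases hx : x = c
      · rw [hx, hc, (hd.2.1 c c).2 rfl]
      · rw [hdw x hx, hWw x hx]
    have hWinj : ∀ x y, W x = W y → x = y := fun x y hxy => by
      by_cases hx : x = c
      · by_contra hne
        have := hW y fun hy => hne (hx.trans hy.symm)
        rw [← hxy, hx, hc] at this
        exact this.false
      · by_cases hy : y = c
        · have := hW x hx
          rw [hxy, hy, hc] at this
          exact this.false.elim
        · exact hinj hx hy (by rw [← hWw x hx, ← hWw y hy, hxy])
    funext x y
    by_cases hxy : x = y
    · rw [heightDist, if_pos hxy, (hd.2.1 x y).2 hxy]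
    · have hne : W x ≠ W y := fun h => hxy (hWinj x y h)
      rw [heightDist, if_neg hxy, if_neg hne, ← hdW x, ← hdW y]
      exact hd.eq_max_of_ne (by rwa [hdW, hdW])
end

section
/- Let (X,d) be a finite ultrametric space with X ∈ ℜ and let (Y,ρ) be a metric space. If (X,d) and (Y,ρ) are weakly similar, then (Y,ρ) is a finite ultrametric space and (Y,ρ) ∈ ℜ. -/
/-- A bijection `Φ : X → Y` is a weak similarity if there is a strictly
increasing bijection `f : Sp(X) → Sp(Y)` with `f(d(x,y)) = ρ(Φ x, Φ y)`. -/
def IsWeakSimilarity {X Y : Type*} [MetricSpace X] [MetricSpace Y]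
    (Φ : X → Y) : Prop :=
  Function.Bijective Φ ∧ ∃ f : ℝ → ℝ,
    Set.BijOn f (metricSpectrum X) (metricSpectrum Y) ∧
    StrictMonoOn f (metricSpectrum X) ∧
    ∀ x y : X, f (dist x y) = dist (Φ x) (Φ y)

namespace IsWeakSimilarity

variable {X Y : Type*} [MetricSpace X] [MetricSpace Y] {Φ : X → Y}

theorem dist_le_dist_iff (h : IsWeakSimilarity Φ) (a b c d : X) :
    dist (Φ a) (Φ b) ≤ dist (Φ c) (Φ d) ↔ dist a b ≤ dist c d := by
  obtain ⟨-, f, -, hmono, hf⟩ := h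
  rw [← hf, ← hf]
  exact hmono.le_iff_le ⟨a, b, rfl⟩ ⟨c, d, rfl⟩

theorem dist_eq_dist_iff (h : IsWeakSimilarity Φ) (a b c d : X) :
    dist (Φ a) (Φ b) = dist (Φ c) (Φ d) ↔ dist a b = dist c d := by
  simp only [le_antisymm_iff, h.dist_le_dist_iff]

theorem isUltrametricDist [IsUltrametricDist X] (h : IsWeakSimilarity Φ) :
    IsUltrametricDist Y := by
  refine ⟨fun x y z => ?_⟩
  obtain ⟨a, rfl⟩ := h.1.2 x
  obtain ⟨b, rfl⟩ := h.1.2 y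
  obtain ⟨c, rfl⟩ := h.1.2 z
  simpa only [le_max_iff, h.dist_le_dist_iff] using IsUltrametricDist.dist_triangle_max a b c

theorem maxRigid (h : IsWeakSimilarity Φ) (hX : maxRigid X) : maxRigid Y := by
  intro g hg hiso
  let e : X ≃ Y := Equiv.ofBijective Φ h.1
  have he (y : Y) : Φ (e.symm y) = y := e.apply_symm_apply y
  have key := hX (e.symm ∘ g ∘ e)
    (e.symm.surjective.comp (hg.comp e.surjective)) fun x y => by
      rw [← h.dist_eq_dist_iff]
      simp only [Function.comp_apply, he]
      exact hiso _ _
  have hfix : {y : Y | g y = y} = e '' {x : X | (e.symm ∘ g ∘ e) x = x} := by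
    ext y
    simp [Equiv.image_eq_preimage_symm]
  rwa [hfix, Set.ncard_image_of_injective _ e.injective, ← Nat.card_congr e]

end IsWeakSimilarity

/-- If a finite ultrametric space `X` belongs to `ℜ` and a
metric space `Y` is weakly similar to `X`, then `Y` is a finite ultrametric
space and `Y ∈ ℜ`. -/
theorem stmt18 (X : Type*) [MetricSpace X] [IsUltrametricDist X] [Fintype X]
    (hcard : 2 ≤ Fintype.card X) (hX : maxRigid X)
    (Y : Type*) [MetricSpace Y] (h : ∃ Φ : X → Y, IsWeakSimilarity Φ) :
    Finite Y ∧ IsUltrametricDist Y ∧ maxRigid Y := by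
  obtain ⟨Φ, hΦ⟩ := h
  exact ⟨Finite.of_surjective Φ hΦ.1.2, hΦ.isUltrametricDist, hΦ.maxRigid hX⟩
end
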